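/- Let k be a positive integer and m an odd positive integer. Every k-connected bipartite finite simple graph G with minimum degree δ(G) ≥ k + (m+1)/2 contains a path P of order m such that the graph G − V(P) obtained by deleting the vertices of P is still k-connected. -/

import Mathlib

/-- A graph `G` is `k`-connected if it has at least `k+1` vertices and removing
any set of fewer than `k` vertices leaves a connected graph. -/
def KConnected {V : Type*} (G : SimpleGraph V) (k : ℕ) : Prop :=
  k + 1 ≤ Nat.card V ∧ ∀ S : Set V, S.ncard < k → (G.induce Sᶜ).Connected

open Finset

/-- `T` separates the nonempty set `A` from the nonempty rest of the graph. -/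
structure Separates {V : Type*} [Fintype V] [DecidableEq V] (G : SimpleGraph V)
    (T A : Finset V) : Prop where
  nonempty : A.Nonempty
  disjoint : Disjoint A T
  rest_nonempty : (A ∪ T)ᶜ.Nonempty
  closed : ∀ a ∈ A, ∀ b, G.Adj a b → b ∈ A ∪ T

/-- `A` is a fragment of `G - R` with respect to a separator of order `k`; the separator is
recorded together with `R`. -/
def IsFragment {V : Type*} [Fintype V] [DecidableEq V] (G : SimpleGraph V)
    (k : ℕ) (R A : Finset V) : Prop :=
  ∃ T, R ⊆ T ∧ #T = #R + k ∧ Separates G T A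

/-- Every separator of `G - R` has order at least `k`. -/
def SeparatorsLarge {V : Type*} [Fintype V] [DecidableEq V] (G : SimpleGraph V)
    (k : ℕ) (R : Finset V) : Prop :=
  ∀ T A, R ⊆ T → Separates G T A → #R + k ≤ #T

section Fragments

variable {V : Type*} [Fintype V] [DecidableEq V] {G : SimpleGraph V} {k : ℕ}
  {R S T A F : Finset V}

theorem Separates.notMem (h : Separates G T A) {x : V} (hx : x ∈ A) : x ∉ T :=
  Finset.disjoint_left.1 h.disjoint hx

theorem Separates.rest (h : Separates G T A) : Separates G T (A ∪ T)ᶜ where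
  nonempty := h.rest_nonempty
  disjoint := by
    rw [Finset.disjoint_left]
    intro x hx hT
    simp [hT] at hx
  rest_nonempty := by
    obtain ⟨a, ha⟩ := h.nonempty
    have := h.notMem ha
    exact ⟨a, by simp [ha, this]⟩
  closed := by
    intro a ha b hab
    by_cases hb : b ∈ A
    · have := h.closed b hb a hab.symm
      simp only [mem_compl] at ha
      exact absurd this ha
    · by_cases hT : b ∈ T <;> simp [hb, hT]

theorem Separates.rest_union_compl (h : Separates G T A) : ((A ∪ T)ᶜ ∪ T)ᶜ = A := by
  ext x
  have : x ∈ A → x ∉ T := h.notMem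
  simp only [mem_compl, mem_union]
  tauto

/-- A common corner of two separations is separated by the union of the adjacent parts. -/
theorem Separates.inter (hF : Separates G S F) (hA : Separates G T A)
    (hne : (F ∩ A).Nonempty) : Separates G (S ∩ A ∪ S ∩ T ∪ F ∩ T) (F ∩ A) where
  nonempty := hne
  disjoint := by
    rw [Finset.disjoint_left]
    intro x hx
    have h1 : x ∈ F → x ∉ S := hF.notMem
    have h2 : x ∈ A → x ∉ T := hA.notMem
    simp only [mem_union, mem_inter] at *
    tauto
  rest_nonempty := by
    obtain ⟨x, hx⟩ := hF.rest_nonempty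
    refine ⟨x, ?_⟩
    simp only [mem_compl, mem_union, mem_inter] at *
    tauto
  closed := by
    intro a ha b hab
    have h1 := hF.closed a (mem_inter.1 ha).1 b hab
    have h2 := hA.closed a (mem_inter.1 ha).2 b hab
    simp only [mem_union, mem_inter] at *
    tauto

/-- The separators of two opposite corners have total size at most that of the original
separators. -/
theorem card_corner_add_card_corner_le (hA : Separates G T A) (hF : Separates G S F) :
    #(S ∩ A ∪ S ∩ T ∪ F ∩ T) + #(S ∩ (A ∪ T)ᶜ ∪ S ∩ T ∪ (F ∪ S)ᶜ ∩ T) ≤ #S + #T := by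
  rw [← card_union_add_card_inter, ← card_union_add_card_inter S T]
  refine add_le_add (card_le_card ?_) (card_le_card ?_)
  · intro x
    simp only [mem_union, mem_inter]
    tauto
  · intro x
    have h1 : x ∈ F → x ∉ S := hF.notMem
    have h2 : x ∈ A → x ∉ T := hA.notMem
    simp only [mem_compl, mem_union, mem_inter]
    tauto

/-- A fragment that survives the deletion of `y` and is not adjacent to `y` was already a
fragment. -/
theorem IsFragment.of_insert {y : V} {D : Finset V} (hyR : y ∉ R)
    (hD : IsFragment G k (insert y R) D) (hy : ∀ d ∈ D, ¬ G.Adj y d) : IsFragment G k R D := by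
  obtain ⟨T, hRT, hT, hsep⟩ := hD
  have hyT : y ∈ T := hRT (mem_insert_self _ _)
  refine ⟨T.erase y, ?_, ?_, hsep.nonempty, hsep.disjoint.mono_right (erase_subset _ _), ?_, ?_⟩
  · intro x hx
    exact mem_erase.2 ⟨fun h => hyR (h ▸ hx), hRT (mem_insert_of_mem hx)⟩
  · rw [card_erase_of_mem hyT, hT, card_insert_of_notMem hyR]
    omega
  · refine hsep.rest_nonempty.mono (compl_subset_compl.2 ?_)
    exact union_subset_union_right (erase_subset _ _)
  · intro a ha b hab
    have h1 := hsep.closed a ha b hab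
    have h2 : b ≠ y := fun h => hy a ha (h ▸ hab.symm)
    simp only [mem_union, mem_erase] at *
    tauto

variable [DecidableRel G.Adj]

theorem Separates.lt_card (hbip : G.Colorable 2)
    (hdeg : ∀ v ∉ R, k + 1 ≤ #(G.neighborFinset v \ R)) (hRT : R ⊆ T) (hT : #T ≤ #R + k)
    (h : Separates G T A) : k + 1 < #A := by
  obtain ⟨c⟩ := hbip
  have hTR : #(T \ R) ≤ k := by rw [card_sdiff_of_subset hRT]; omega
  have hsub : ∀ a ∈ A, G.neighborFinset a \ R ⊆ A ∪ T \ R := by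
    intro a ha b hb
    have := h.closed a ha b (by simpa using (mem_sdiff.1 hb).1)
    have hb := (mem_sdiff.1 hb).2
    simp only [mem_union, mem_sdiff] at *
    tauto
  have hAR : ∀ a ∈ A, a ∉ R := fun a ha hR => h.notMem ha (hRT hR)
  obtain ⟨a, ha⟩ := h.nonempty
  obtain ⟨a', ha', haa⟩ : ∃ a' ∈ A, G.Adj a a' := by
    by_contra! hno
    have : G.neighborFinset a \ R ⊆ T \ R := by
      intro b hb
      rcases mem_union.1 (hsub a ha hb) with h' | h'
      · exact absurd (by simpa using (mem_sdiff.1 hb).1) (hno b h')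
      · exact h'
    have := card_le_card this
    have := hdeg a (hAR a ha)
    omega
  have hdisj : Disjoint (G.neighborFinset a \ R) (G.neighborFinset a' \ R) := by
    rw [Finset.disjoint_left]
    intro b hb hb'
    have h1 := c.valid (show G.Adj a b by simpa using (mem_sdiff.1 hb).1)
    have h2 := c.valid (show G.Adj a' b by simpa using (mem_sdiff.1 hb').1)
    have h3 := c.valid haa
    omega
  have h1 := card_le_card (union_subset (hsub a ha) (hsub a' ha'))
  rw [card_union_of_disjoint hdisj] at h1
  have h2 := card_union_le A (T \ R)
  have h3 := hdeg a (hAR a ha)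
  have h4 := hdeg a' (hAR a' ha')
  omega

/-- Deleting a vertex of an inclusion-minimal fragment keeps all separators large. -/
theorem SeparatorsLarge.insert_of_minimal_fragment (hbip : G.Colorable 2)
    (hdeg : ∀ v ∉ R, k + 1 ≤ #(G.neighborFinset v \ R)) (hR : SeparatorsLarge G k R)
    (hF : IsFragment G k R F) (hmin : ∀ D, D ⊂ F → ¬ IsFragment G k R D)
    {y : V} (hy : y ∈ F) : SeparatorsLarge G k (insert y R) := by
  obtain ⟨S, hRS, hS, hF⟩ := hF
  have hyR : y ∉ R := fun h => hF.notMem hy (hRS h)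
  intro T A hRT hA
  by_contra! hlt
  rw [card_insert_of_notMem hyR] at hlt
  have hyT : y ∈ T := hRT (mem_insert_self _ _)
  have hRT : R ⊆ T := (subset_insert _ _).trans hRT
  have hT : #T = #R + k := le_antisymm (by omega) (hR T A hRT hA)
  have key : ∀ B, Separates G T B → (F ∩ B).Nonempty → (F ∪ S)ᶜ ∩ (B ∪ T)ᶜ = ∅ := by
    intro B hB hne
    by_contra hne'
    have hsep := hF.inter hB hne
    have hsep' := hF.rest.inter hB.rest (nonempty_iff_ne_empty.2 hne')
    have hsum := card_corner_add_card_corner_le hB hF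
    have hsubR : R ⊆ S ∩ B ∪ S ∩ T ∪ F ∩ T := fun x hx => by simp [hRS hx, hRT hx]
    have h1 := hR _ _ hsubR hsep
    have h2 := hR _ _ (fun x hx => by simp [hRS hx, hRT hx]) hsep'
    refine hmin (F ∩ B) ?_ ⟨_, hsubR, by omega, hsep⟩
    refine (Finset.ssubset_iff_of_subset inter_subset_left).2 ⟨y, hy, fun h => ?_⟩
    exact hB.notMem (mem_inter.1 h).2 hyT
  have large := fun {U B : Finset V} => Separates.lt_card (T := U) (A := B) hbip hdeg
  have hFk := large hRS hS.le hF
  have hFk' := large hRS hS.le hF.rest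
  -- No side of `T` meets `F`: otherwise `T` or `S` would contain a whole side of the other.
  have main : ∀ B, Separates G T B → (F ∩ B).Nonempty → False := by
    intro B hB hne
    have he := key B hB hne
    by_cases hne' : (F ∩ (B ∪ T)ᶜ).Nonempty
    · have he' := key _ hB.rest hne'
      rw [hB.rest_union_compl] at he'
      have hsub : (F ∪ S)ᶜ ⊆ T \ R := by
        intro x hx
        have h1 : x ∉ (F ∪ S)ᶜ ∩ (B ∪ T)ᶜ := he ▸ notMem_empty x
        have h2 : x ∉ (F ∪ S)ᶜ ∩ B := he' ▸ notMem_empty x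
        have h3 := @hRS x
        simp only [mem_compl, mem_union, mem_inter, mem_sdiff] at *
        tauto
      have := card_le_card hsub
      rw [card_sdiff_of_subset hRT] at this
      omega
    · have hsub : (B ∪ T)ᶜ ⊆ S \ R := by
        intro x hx
        have h1 : x ∉ (F ∪ S)ᶜ ∩ (B ∪ T)ᶜ := he ▸ notMem_empty x
        have h2 : x ∉ F ∩ (B ∪ T)ᶜ := (not_nonempty_iff_eq_empty.1 hne') ▸ notMem_empty x
        have h3 := @hRT x
        simp only [mem_compl, mem_union, mem_inter, mem_sdiff] at *
        tauto
      have := card_le_card hsub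
      rw [card_sdiff_of_subset hRS] at this
      have := large hRT hT.le hB.rest
      omega
  have hne : ¬ F ⊆ T \ R := by
    intro hsub
    have := card_le_card hsub
    rw [card_sdiff_of_subset hRT] at this
    omega
  obtain ⟨x, hxF, hx⟩ := Finset.not_subset.1 hne
  have hxR : x ∉ R := fun h => hF.notMem hxF (hRS h)
  by_cases hxA : x ∈ A
  · exact main A hA ⟨x, mem_inter.2 ⟨hxF, hxA⟩⟩
  · refine main _ hA.rest ⟨x, mem_inter.2 ⟨hxF, ?_⟩⟩
    simp only [mem_compl, mem_union, mem_sdiff] at *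
    tauto

/-- `G - R` has no small separators, and there is a region (a fragment or everything) all of
whose fragments meet `N`. -/
def Extendable (G : SimpleGraph V) (k : ℕ) (R N : Finset V) : Prop :=
  SeparatorsLarge G k R ∧ ∃ F, (F = univ ∨ IsFragment G k R F) ∧
    ∀ D ⊆ F, IsFragment G k R D → (D ∩ N).Nonempty

theorem Extendable.exists_insert {N : Finset V} (hbip : G.Colorable 2)
    (hdeg : ∀ v ∉ R, k + 1 ≤ #(G.neighborFinset v \ R)) (h : Extendable G k R N)
    (hN : (N \ R).Nonempty) :
    ∃ y ∈ N, y ∉ R ∧ Extendable G k (insert y R) (G.neighborFinset y) := by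
  obtain ⟨hR, F, hF, hFN⟩ := h
  by_cases hex : ∃ D ⊆ F, IsFragment G k R D
  · obtain ⟨F', ⟨hF'F, hF'⟩, hmin⟩ := WellFounded.has_min
      (wellFounded_lt (α := Finset V)) {D | D ⊆ F ∧ IsFragment G k R D} hex
    have hmin : ∀ D, D ⊂ F' → ¬ IsFragment G k R D := fun D hD hfrag =>
      hmin D ⟨hD.subset.trans hF'F, hfrag⟩ hD
    obtain ⟨y, hy⟩ := hFN F' hF'F hF'
    obtain ⟨hyF, hyN⟩ := mem_inter.1 hy
    have hlarge := hR.insert_of_minimal_fragment hbip hdeg hF' hmin hyF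
    obtain ⟨S, hRS, hS, hsep⟩ := hF'
    have hyS : y ∉ S := hsep.notMem hyF
    have hyR : y ∉ R := fun h => hyS (hRS h)
    have hcard := hsep.lt_card hbip hdeg hRS hS.le
    refine ⟨y, hyN, hyR, hlarge, F'.erase y, Or.inr ?_, ?_⟩
    · have hunion : F'.erase y ∪ insert y S = F' ∪ S := by
        ext x
        simp only [mem_union, mem_erase, mem_insert]
        by_cases hxy : x = y
        · subst hxy; simp [hyF]
        · simp [hxy]
      refine ⟨insert y S, insert_subset_insert _ hRS, ?_, ?_, ?_, ?_, ?_⟩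
      · rw [card_insert_of_notMem hyS, card_insert_of_notMem hyR]; omega
      · rw [← card_pos, card_erase_of_mem hyF]
        omega
      · rw [Finset.disjoint_left]
        intro x hx
        have := hsep.notMem (mem_erase.1 hx).2
        simp [(mem_erase.1 hx).1, this]
      · rw [hunion]; exact hsep.rest_nonempty
      · rw [hunion]; exact fun a ha => hsep.closed a (mem_erase.1 ha).2
    · intro D hDF hD
      by_contra hno
      refine hmin D (hDF.trans_ssubset (erase_ssubset hyF)) (hD.of_insert hyR fun d hd hadj => ?_)
      exact hno ⟨d, mem_inter.2 ⟨hd, by simpa using hadj⟩⟩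
  · push Not at hex
    have hFu : F = univ := hF.resolve_right (hex F subset_rfl)
    subst hFu
    obtain ⟨y, hy⟩ := hN
    obtain ⟨hyN, hyR⟩ := mem_sdiff.1 hy
    refine ⟨y, hyN, hyR, ?_, univ, Or.inl rfl, ?_⟩
    · intro T A hRT hA
      by_contra! hlt
      rw [card_insert_of_notMem hyR] at hlt
      have hRT := (subset_insert _ _).trans hRT
      exact hex A (subset_univ _) ⟨T, hRT, le_antisymm (by omega) (hR T A hRT hA), hA⟩
    · intro D _ hD
      by_contra hno
      refine hex D (subset_univ _) (hD.of_insert hyR fun d hd hadj => ?_)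
      exact hno ⟨d, mem_inter.2 ⟨hd, by simpa using hadj⟩⟩

end Fragments

/-- In a properly 2-coloured graph the colours alternate along a walk. -/
theorem SimpleGraph.Walk.countP_color_le {V : Type*} {G : SimpleGraph V}
    (c : G.Coloring (Fin 2)) {u v : V} (p : G.Walk u v) :
    (∀ i, i = c u → 2 * p.support.countP (c · = i) ≤ p.support.length + 1) ∧
      ∀ i, i ≠ c u → 2 * p.support.countP (c · = i) ≤ p.support.length := by
  induction p with
  | nil =>
    refine ⟨fun i hi => ?_, fun i hi => ?_⟩ <;> simp [hi, eq_comm]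
  | cons h p ih =>
    have hc := c.valid h
    refine ⟨fun i hi => ?_, fun i hi => ?_⟩
    · have := ih.2 i (hi ▸ hc)
      simp only [SimpleGraph.Walk.support_cons, List.countP_cons, List.length_cons]
      split <;> omega
    · have := ih.1 i (by omega)
      simp only [SimpleGraph.Walk.support_cons, List.countP_cons, List.length_cons]
      simp only [decide_eq_true_eq, hi.symm, if_false]
      omega

section Bridges

variable {V : Type*} [Fintype V] [DecidableEq V] {G : SimpleGraph V} {k : ℕ}

theorem KConnected.separatorsLarge (h : KConnected G k) : SeparatorsLarge G k ∅ := by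
  intro T A _ hsep
  by_contra! hlt
  have hconn := h.2 (T : Set V) (by simpa [Set.ncard_coe_finset] using hlt)
  obtain ⟨a, ha⟩ := hsep.nonempty
  obtain ⟨b, hb⟩ := hsep.rest_nonempty
  simp only [mem_compl, mem_union, not_or] at hb
  have haT : a ∉ T := hsep.notMem ha
  obtain ⟨w⟩ := hconn.preconnected ⟨a, by simpa using haT⟩ ⟨b, by simpa using hb.2⟩
  have stay : ∀ {x y : ((T : Set V)ᶜ : Set V)} (w : (G.induce (T : Set V)ᶜ).Walk x y),
      (x : V) ∈ A → (y : V) ∈ A := by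
    intro x y w
    induction w with
    | nil => exact id
    | @cons x z y hxz _ ih =>
      intro hx
      refine ih ((mem_union.1 (hsep.closed x hx z (by simpa using hxz))).resolve_right ?_)
      exact fun hz => z.2 (mem_coe.2 hz)
  exact hb.1 (stay w ha)

theorem SeparatorsLarge.kConnected_induce {R : Finset V} {X : Set V} (hX : X = (R : Set V)ᶜ)
    (h : SeparatorsLarge G k R) (hcard : #R + k + 1 ≤ Fintype.card V) :
    KConnected (G.induce X) k := by
  classical
  subst hX
  have hncard : Nat.card ((R : Set V)ᶜ : Set V) = Fintype.card V - #R := by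
    rw [Nat.card_coe_set_eq, ← coe_compl, Set.ncard_coe_finset, card_compl]
  refine ⟨by omega, fun S hS => ?_⟩
  have hSfin : S.Finite := Set.toFinite S
  obtain ⟨T, hTdef⟩ : ∃ T : Finset V, T = R ∪ hSfin.toFinset.image Subtype.val := ⟨_, rfl⟩
  have hT : #T < #R + k := by
    have h1 := card_union_le R (hSfin.toFinset.image Subtype.val)
    have h2 := card_image_le (s := hSfin.toFinset) (f := Subtype.val)
    rw [Set.ncard_eq_toFinset_card S hSfin] at hS
    rw [hTdef]
    omega
  have hmemT : ∀ x (hx : x ∈ ((R : Set V)ᶜ : Set V)), x ∈ T ↔ (⟨x, hx⟩ : ↥(R : Set V)ᶜ) ∈ S := by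
    intro x hx
    have hx' : x ∉ R := by simpa using hx
    simp [hTdef, hx']
  have hne : Nonempty ↥Sᶜ := by
    rw [Set.nonempty_coe_sort]
    by_contra hempty
    rw [Set.not_nonempty_iff_eq_empty, Set.compl_empty_iff] at hempty
    rw [hempty, Set.ncard_univ] at hS
    omega
  refine ⟨fun u v => ?_⟩
  by_contra hnr
  let H := (G.induce (R : Set V)ᶜ).induce Sᶜ
  let A : Finset V := univ.filter fun x =>
    ∃ (hx : x ∈ ((R : Set V)ᶜ : Set V)) (hs : (⟨x, hx⟩ : ↥(R : Set V)ᶜ) ∈ Sᶜ),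
      H.Reachable u ⟨⟨x, hx⟩, hs⟩
  have hA : ∀ x, x ∈ A ↔ ∃ (hx : x ∈ ((R : Set V)ᶜ : Set V))
      (hs : (⟨x, hx⟩ : ↥(R : Set V)ᶜ) ∈ Sᶜ), H.Reachable u ⟨⟨x, hx⟩, hs⟩ := by simp [A]
  refine absurd (h T A (hTdef ▸ subset_union_left) ⟨⟨u.1.1, ?_⟩, ?_, ⟨v.1.1, ?_⟩, ?_⟩) (by omega)
  · exact (hA _).2 ⟨u.1.2, u.2, SimpleGraph.Reachable.refl _⟩
  · rw [Finset.disjoint_left]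
    intro x hx hxT
    obtain ⟨hx, hs, _⟩ := (hA x).1 hx
    exact hs ((hmemT x hx).1 hxT)
  · rw [mem_compl, mem_union, hA]
    rintro (⟨_, _, hr⟩ | hvT)
    · exact hnr hr
    · exact v.2 ((hmemT _ v.1.2).1 hvT)
  · intro a ha b hab
    obtain ⟨hx, hs, hr⟩ := (hA a).1 ha
    by_cases hbT : b ∈ T
    · exact mem_union_right _ hbT
    · have hbR : b ∈ ((R : Set V)ᶜ : Set V) := by
        simpa using fun hb => hbT (hTdef ▸ mem_union_left _ hb)
      have hbS : (⟨b, hbR⟩ : ↥(R : Set V)ᶜ) ∈ Sᶜ := fun hb => hbT ((hmemT b hbR).2 hb)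
      refine mem_union_left _ ((hA b).2 ⟨hbR, hbS, hr.trans ?_⟩)
      exact SimpleGraph.Adj.reachable (G := H) (by simpa [H] using hab)

theorem le_card_neighborFinset_sdiff_support [DecidableRel G.Adj] (hbip : G.Colorable 2) {d : ℕ}
    {u v : V} (p : G.Walk u v) (hdeg : d + (p.support.length + 1) / 2 ≤ G.minDegree) (x : V) :
    d ≤ #(G.neighborFinset x \ p.support.toFinset) := by
  obtain ⟨c⟩ := hbip
  obtain ⟨i, hi⟩ : ∃ i : Fin 2, ∀ y, G.Adj x y → c y = i :=
    ⟨1 - c x, fun y hxy => by have := c.valid hxy; omega⟩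
  have hcount : 2 * p.support.countP (c · = i) ≤ p.support.length + 1 := by
    have := p.countP_color_le c
    by_cases h : i = c u
    · exact this.1 i h
    · exact (this.2 i h).trans (Nat.le_succ _)
  have hinter : #(p.support.toFinset ∩ G.neighborFinset x) ≤ p.support.countP (c · = i) := by
    rw [List.countP_eq_length_filter]
    refine le_trans (card_le_card ?_) (List.toFinset_card_le _)
    intro y hy
    obtain ⟨h1, h2⟩ := mem_inter.1 hy
    simpa using ⟨by simpa using h1, hi y (by simpa using h2)⟩
  have h1 := G.minDegree_le_degree x
  have h2 := card_sdiff (s := p.support.toFinset) (t := G.neighborFinset x)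
  rw [SimpleGraph.card_neighborFinset_eq_degree] at h2
  omega

/-- Paths of every order up to the bound can be grown so that the rest stays extendable. -/
theorem exists_path_extendable [DecidableRel G.Adj] (hbip : G.Colorable 2)
    (hG : KConnected G k) (n : ℕ) (hdeg : k + 1 + (n + 1) / 2 ≤ G.minDegree) :
    ∃ (u v : V) (p : G.Walk u v), p.IsPath ∧ p.support.length = n + 1 ∧
      n + 1 + k + 1 ≤ Fintype.card V ∧
      Extendable G k p.support.toFinset (G.neighborFinset u) := by
  have card_bound : ∀ {R : Finset V} {y : V}, y ∉ R → k + 1 ≤ #(G.neighborFinset y \ R) →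
      #R + 1 + k + 1 ≤ Fintype.card V := by
    intro R y hy hle
    have hdisj : Disjoint (insert y R) (G.neighborFinset y \ R) := by
      rw [Finset.disjoint_left]
      intro x hx hx'
      simp only [mem_insert, mem_sdiff, SimpleGraph.mem_neighborFinset] at hx hx'
      rcases hx with rfl | hx
      · exact G.loopless.irrefl _ hx'.1
      · exact hx'.2 hx
    have h1 := card_le_univ (insert y R ∪ (G.neighborFinset y \ R))
    rw [card_union_of_disjoint hdisj, card_insert_of_notMem hy] at h1
    omega
  induction n with
  | zero =>
    have hne : Nonempty V := by
      by_contra h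
      rw [not_nonempty_iff] at h
      have := hG.1
      simp at this
    have hdeg' : ∀ v ∉ (∅ : Finset V), k + 1 ≤ #(G.neighborFinset v \ ∅) := by
      intro v _
      have := G.minDegree_le_degree v
      rw [sdiff_empty, SimpleGraph.card_neighborFinset_eq_degree]
      omega
    obtain ⟨y, -, hy, hext⟩ := Extendable.exists_insert (R := ∅) (N := univ) hbip hdeg'
      ⟨hG.separatorsLarge, univ, Or.inl rfl, fun D _ hD => by
        obtain ⟨_, _, _, hsep⟩ := hD
        simpa using hsep.nonempty⟩ (by simp)
    refine ⟨y, y, .nil, .nil, rfl, ?_, by simpa using hext⟩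
    simpa using card_bound hy (hdeg' y hy)
  | succ n ih =>
    obtain ⟨u, v, p, hp, hlen, -, hext⟩ := ih (by omega)
    have hdeg' : ∀ x, k + 1 ≤ #(G.neighborFinset x \ p.support.toFinset) :=
      le_card_neighborFinset_sdiff_support hbip p (by rw [hlen]; omega)
    obtain ⟨y, hyu, hy, hext'⟩ := hext.exists_insert hbip (fun x _ => hdeg' x)
      (card_pos.1 (by have := hdeg' u; omega))
    have hadj : G.Adj y u := by simpa [SimpleGraph.adj_comm] using hyu
    have hcard : #p.support.toFinset = n + 1 := by
      rw [List.toFinset_card_of_nodup hp.support_nodup, hlen]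
    refine ⟨y, v, .cons hadj p, hp.cons (by simpa using hy), by simp [hlen], ?_,
      by simpa using hext'⟩
    have := card_bound hy (hdeg' y)
    omega

end Bridges

theorem connectivity_keeping_odd_path_bipartite
    {V : Type} [Fintype V] (G : SimpleGraph V) [DecidableRel G.Adj]
    (k m : ℕ) (hk : 1 ≤ k) (hm : 1 ≤ m) (hodd : Odd m)
    (hGconn : KConnected G k) (hGbip : G.Colorable 2)
    (hdeg : k + (m + 1) / 2 ≤ G.minDegree) :
    ∃ (u v : V) (P : G.Walk u v), P.IsPath ∧ P.support.length = m ∧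
      KConnected (G.induce {x | x ∈ P.support}ᶜ) k := by
  classical
  obtain ⟨n, rfl⟩ := hodd
  obtain ⟨u, v, p, hp, hlen, hcard, hext⟩ :=
    exists_path_extendable hGbip hGconn (2 * n) (by omega)
  refine ⟨u, v, p, hp, hlen, hext.1.kConnected_induce (R := p.support.toFinset) ?_ ?_⟩
  · ext x; simp
  · rw [List.toFinset_card_of_nodup hp.support_nodup, hlen]
    omega
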